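/- Let d ≥ 1, k ∈ ℕ, j ∈ {1,…,d}, and let E ⊆ (0,∞) be measurable. Define 𝔘(z,t) = (t^{k+1}/(2√π)) ∫_E ∂_t^k( t e^{−t²/(4u)} ) ∂_{z_j} W_u(z) u^{−3/2} du for z ∈ ℝ^d and t > 0. Then there exists C > 0, depending only on d and k (and in particular independent of E), such that for every f ∈ C_c^∞(ℝ^d), ∫_{ℝ^d} ∫₀^∞ | ∫_{ℝ^d} f(y) 𝔘(x−y,t) dy |² (dt/t) dx ≤ C ‖f‖²_{L²(ℝ^d,dx)}. -/

import Mathlib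

open MeasureTheory Matrix
open scoped ENNReal

noncomputable section

/-- The squared Euclidean norm `|x|²` on `ℝ^d`. -/
def nrm2 {d : ℕ} (x : Fin d → ℝ) : ℝ := ∑ i, x i ^ 2

/-- The Euclidean norm `|x|` on `ℝ^d`. -/
def nrm {d : ℕ} (x : Fin d → ℝ) : ℝ := Real.sqrt (nrm2 x)

/-- The classical heat kernel `W_u(z) = (2πu)^{-d/2} e^{-|z|²/(2u)}`. -/
def heatKer (d : ℕ) (u : ℝ) (z : Fin d → ℝ) : ℝ :=
  (2 * Real.pi * u) ^ (-(d : ℝ)/2) * Real.exp (-(nrm2 z)/(2*u))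

/-- The kernel
`𝔘(z,t) = (t^{k+1}/(2√π)) ∫_E ∂_t^k(t e^{-t²/(4(u+h))}) ∂_{z_j} W_u(z) (u+h)^{-3/2} du`. -/
def Ufrak (d k : ℕ) (j : Fin d) (E : Set ℝ) (h : ℝ) (z : Fin d → ℝ) (t : ℝ) : ℝ :=
  (t ^ (k+1) / (2 * Real.sqrt Real.pi)) *
    ∫ u in E, iteratedDeriv k (fun r => r * Real.exp (-(r^2)/(4*(u+h)))) t *
      fderiv ℝ (fun w => heatKer d u w) z (Pi.single j 1) * (u + h) ^ (-(3:ℝ)/2)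

def gK (s : ℝ) : ℝ := s * Real.exp (-(s^2)/4)

lemma gK_contDiff : ContDiff ℝ (⊤ : ℕ∞) gK := by
  unfold gK; fun_prop

lemma gK_iter (k : ℕ) : ∃ P : Polynomial ℝ,
    iteratedDeriv k gK = fun s => P.eval s * Real.exp (-(s^2)/4) := by
  induction k with
  | zero => exact ⟨Polynomial.X, by simp [iteratedDeriv_zero]; rfl⟩
  | succ k ih =>
    obtain ⟨P, hP⟩ := ih
    refine ⟨P.derivative - Polynomial.C (1/2) * Polynomial.X * P, ?_⟩
    rw [iteratedDeriv_succ, hP]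
    ext s
    have h1 : HasDerivAt (fun s : ℝ => Real.exp (-(s^2)/4))
        (Real.exp (-(s^2)/4) * (-(2 * s)/4)) s := by
      have : HasDerivAt (fun s : ℝ => -(s^2)/4) (-(2 * s)/4) s := by
        simpa using ((hasDerivAt_pow 2 s).neg.div_const 4)
      exact this.exp
    have h2 := (P.hasDerivAt s).mul h1
    rw [show (fun s => P.eval s * Real.exp (-(s^2)/4)) = ((fun s => P.eval s) * fun s => Real.exp (-(s^2)/4)) from rfl, h2.deriv]
    simp
    ring

lemma pow_gauss_bdd (n : ℕ) (s : ℝ) (hs : 0 ≤ s) :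
    s ^ n * Real.exp (-(s^2)/4) ≤ n.factorial * Real.exp 1 := by
  have h1 : s ^ n ≤ n.factorial * Real.exp s := by
    have := Real.pow_div_factorial_le_exp s hs n
    rwa [div_le_iff₀' (by positivity)] at this
  calc s ^ n * Real.exp (-(s^2)/4) ≤ n.factorial * Real.exp s * Real.exp (-(s^2)/4) := by gcongr
    _ = n.factorial * Real.exp (s + -(s^2)/4) := by rw [Real.exp_add]; ring
    _ ≤ _ := by
      gcongr
      nlinarith [sq_nonneg (s - 2)]

lemma poly_gauss_bdd (P : Polynomial ℝ) : ∃ C : ℝ, 0 ≤ C ∧ ∀ s : ℝ, 0 ≤ s →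
    |P.eval s * Real.exp (-(s^2)/4)| ≤ C := by
  induction P using Polynomial.induction_on' with
  | add p q hp hq =>
    obtain ⟨C, hC, h⟩ := hp
    obtain ⟨D, hD, h'⟩ := hq
    refine ⟨C + D, by positivity, fun s hs => ?_⟩
    rw [Polynomial.eval_add, add_mul]
    exact (abs_add_le _ _).trans (add_le_add (h s hs) (h' s hs))
  | monomial n a =>
    refine ⟨|a| * (n.factorial * Real.exp 1), by positivity, fun s hs => ?_⟩
    rw [Polynomial.eval_monomial, mul_assoc, abs_mul, abs_of_nonneg (a := s ^ n * _) (by positivity)]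
    exact mul_le_mul_of_nonneg_left (pow_gauss_bdd n s hs) (abs_nonneg a)

lemma gK_bound (k : ℕ) : ∃ C : ℝ, 0 < C ∧ ∀ s : ℝ, 0 ≤ s →
    |s ^ k * iteratedDeriv k gK s| * (1 + s ^ 2) ≤ C := by
  obtain ⟨P, hP⟩ := gK_iter k
  obtain ⟨C, hC, h⟩ := poly_gauss_bdd (Polynomial.X ^ k * P * (1 + Polynomial.X ^ 2))
  refine ⟨C + 1, by positivity, fun s hs => ?_⟩
  have := h s hs
  rw [hP]
  have h2 : |s ^ k * (P.eval s * Real.exp (-(s^2)/4))| * (1 + s ^ 2)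
      = |(Polynomial.X ^ k * P * (1 + Polynomial.X ^ 2)).eval s * Real.exp (-(s^2)/4)| := by
    conv_lhs => rw [← abs_of_nonneg (a := 1 + s^2) (by positivity)]
    rw [← abs_mul]
    congr 1
    simp
    ring
  simp only
  linarith

/-- the scaled kernel in `u` -/
def PhiK (k : ℕ) (t u : ℝ) : ℝ :=
  (t ^ (k+1) / (2 * Real.sqrt Real.pi)) *
    (Real.sqrt u * ((Real.sqrt u)⁻¹ ^ k * iteratedDeriv k gK ((Real.sqrt u)⁻¹ * t))
      * u ^ (-(3:ℝ)/2))

lemma iter_eq (k : ℕ) (t u : ℝ) (hu : 0 < u) :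
    iteratedDeriv k (fun r => r * Real.exp (-(r^2)/(4*(u+0)))) t =
      Real.sqrt u * ((Real.sqrt u)⁻¹ ^ k * iteratedDeriv k gK ((Real.sqrt u)⁻¹ * t)) := by
  have hs : 0 < Real.sqrt u := Real.sqrt_pos.2 hu
  have hsq : Real.sqrt u ^ 2 = u := Real.sq_sqrt hu.le
  have : (fun r => r * Real.exp (-(r^2)/(4*(u+0)))) =
      fun r => Real.sqrt u * (fun x => gK ((Real.sqrt u)⁻¹ * x)) r := by
    ext r
    simp only [gK]
    rw [mul_pow, inv_pow, hsq, add_zero]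
    have : -(u⁻¹ * r ^ 2) / 4 = -r ^ 2 / (4 * u) := by field_simp
    rw [this]
    field_simp
  rw [this, iteratedDeriv_const_mul_field, iteratedDeriv_comp_const_mul]
  exact gK_contDiff.of_le (by exact_mod_cast le_top)

lemma PhiK_measurable (k : ℕ) : Measurable (fun p : ℝ × ℝ => PhiK k p.1 p.2) := by
  have : Continuous (iteratedDeriv k gK) :=
    gK_contDiff.continuous_iteratedDeriv k (by exact_mod_cast le_top)
  have := this.measurable
  unfold PhiK
  fun_prop

lemma PhiK_bound (k : ℕ) : ∃ C : ℝ, 0 < C ∧ ∀ t u : ℝ, 0 < t → 0 < u →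
    |PhiK k t u| ≤ C * (t / (u + t ^ 2)) := by
  obtain ⟨C, hC, h⟩ := gK_bound k
  refine ⟨C / (2 * Real.sqrt Real.pi), by positivity, fun t u ht hu => ?_⟩
  have hs : 0 < Real.sqrt u := Real.sqrt_pos.2 hu
  have hsq : Real.sqrt u ^ 2 = u := Real.sq_sqrt hu.le
  set v := Real.sqrt u with hv
  have hu3 : u ^ (-(3:ℝ)/2) = (v ^ 3)⁻¹ := by
    rw [hv, Real.sqrt_eq_rpow, ← Real.rpow_natCast, ← Real.rpow_mul hu.le, ← Real.rpow_neg hu.le]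
    norm_num
  have h1 := h (v⁻¹ * t) (by positivity)
  have e : PhiK k t u = (t / (2 * Real.sqrt Real.pi)) * (v ^ 2)⁻¹ *
      ((v⁻¹ * t) ^ k * iteratedDeriv k gK (v⁻¹ * t)) := by
    unfold PhiK
    rw [← hv, hu3, mul_pow]
    field_simp
    ring
  rw [e, abs_mul, abs_of_nonneg (a := (t / (2 * Real.sqrt Real.pi)) * (v ^ 2)⁻¹) (by positivity)]
  rw [← le_div_iff₀ (by positivity)] at h1
  calc _ ≤ (t / (2 * Real.sqrt Real.pi)) * (v ^ 2)⁻¹ * (C / (1 + (v⁻¹ * t) ^ 2)) := by gcongr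
    _ = _ := by rw [← hsq]; field_simp

lemma lint_u (t : ℝ) (ht : 0 < t) :
    ∫⁻ u in Set.Ioi (0:ℝ), ENNReal.ofReal (t / (u + t ^ 2) * (Real.sqrt u)⁻¹)
      = ENNReal.ofReal Real.pi := by
  have hd : ∀ x ∈ Set.Ioi (0:ℝ), HasDerivAt (fun u => 2 * Real.arctan (Real.sqrt u / t))
      (t / (x + t ^ 2) * (Real.sqrt x)⁻¹) x := by
    intro x hx
    have hx' : 0 < x := hx
    have hs : 0 < Real.sqrt x := Real.sqrt_pos.2 hx'
    have h := (((Real.hasDerivAt_sqrt hx'.ne').div_const t).arctan).const_mul 2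
    refine h.congr_deriv ?_
    rw [div_pow, Real.sq_sqrt hx'.le]
    field_simp
    ring
  have hp : ∀ x ∈ Set.Ioi (0:ℝ), 0 ≤ t / (x + t ^ 2) * (Real.sqrt x)⁻¹ := by
    intro x hx
    have hx' : 0 < x := hx
    positivity
  have hc : ContinuousWithinAt (fun u => 2 * Real.arctan (Real.sqrt u / t)) (Set.Ici 0) 0 := by
    apply Continuous.continuousWithinAt
    have := Real.continuous_arctan
    fun_prop
  have hl : Filter.Tendsto (fun u => 2 * Real.arctan (Real.sqrt u / t)) Filter.atTop
      (nhds Real.pi) := by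
    have h1 : Filter.Tendsto (fun u => Real.sqrt u / t) Filter.atTop Filter.atTop :=
      Real.tendsto_sqrt_atTop.atTop_div_const ht
    have h2 := ((Real.tendsto_arctan_atTop.mono_right nhdsWithin_le_nhds).comp h1).const_mul 2
    rw [mul_div_cancel₀ _ (two_ne_zero)] at h2
    exact h2
  have hi := integrableOn_Ioi_deriv_of_nonneg hc hd hp hl
  have he := integral_Ioi_of_hasDerivAt_of_nonneg hc hd hp hl
  rw [← ofReal_integral_eq_lintegral_ofReal hi, he]
  · simp
  · exact (ae_restrict_mem measurableSet_Ioi).mono hp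

lemma lint_t (u : ℝ) (hu : 0 < u) :
    ∫⁻ t in Set.Ioi (0:ℝ), ENNReal.ofReal (Real.sqrt u / (u + t ^ 2))
      = ENNReal.ofReal (Real.pi / 2) := by
  have hs : 0 < Real.sqrt u := Real.sqrt_pos.2 hu
  have hsq : Real.sqrt u ^ 2 = u := Real.sq_sqrt hu.le
  have hd : ∀ x ∈ Set.Ici (0:ℝ), HasDerivAt (fun t => Real.arctan (t / Real.sqrt u))
      (Real.sqrt u / (u + x ^ 2)) x := by
    intro x hx
    have h := (((hasDerivAt_id x).div_const (Real.sqrt u)).arctan)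
    refine h.congr_deriv ?_
    simp only [id]
    rw [div_pow, hsq]
    field_simp
    rw [hsq]
  have hp : ∀ x ∈ Set.Ioi (0:ℝ), 0 ≤ Real.sqrt u / (u + x ^ 2) := by
    intro x hx
    positivity
  have hl : Filter.Tendsto (fun t => Real.arctan (t / Real.sqrt u)) Filter.atTop
      (nhds (Real.pi / 2)) := by
    have h1 : Filter.Tendsto (fun t => t / Real.sqrt u) Filter.atTop Filter.atTop :=
      Filter.tendsto_id.atTop_div_const hs
    exact ((Real.tendsto_arctan_atTop.mono_right nhdsWithin_le_nhds).comp h1)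
  have hi := integrableOn_Ioi_deriv_of_nonneg' hd hp hl
  have he := integral_Ioi_of_hasDerivAt_of_nonneg' hd hp hl
  rw [← ofReal_integral_eq_lintegral_ofReal hi, he]
  · simp
  · exact (ae_restrict_mem measurableSet_Ioi).mono hp
open FourierTransform SchwartzMap in
lemma gauss_temperate {V : Type*} [NormedAddCommGroup V] [InnerProductSpace ℝ V] (b : ℝ)
    (hb : 0 ≤ b) : (fun v : V => Real.exp (-(b * ‖v‖ ^ 2))).HasTemperateGrowth := by
  have h : (fun v : V => Real.exp (-(b * ‖v‖ ^ 2))) =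
      (fun s => Real.exp (-s)) ∘ (fun v : V => b * ‖v‖ ^ 2) := rfl
  rw [h]
  apply Function.HasTemperateGrowth.comp' (t := Set.Ioi (-1))
  · rintro - ⟨v, rfl⟩
    simp only [Set.mem_Ioi]
    have : 0 ≤ b * ‖v‖ ^ 2 := by positivity
    linarith
  · exact isOpen_Ioi.uniqueDiffOn
  · have : ContDiff ℝ (⊤ : ℕ∞) (fun s : ℝ => Real.exp (-s)) := by fun_prop
    exact this.contDiffOn
  · intro N
    refine ⟨0, Real.exp 1, by positivity, fun n hn x hx => ?_⟩
    have hc : ContDiffAt ℝ n (fun s : ℝ => Real.exp (-s)) x := by fun_prop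
    rw [norm_iteratedFDerivWithin_eq_norm_iteratedDerivWithin,
      iteratedDerivWithin_eq_iteratedDeriv isOpen_Ioi.uniqueDiffOn hc hx]
    have : iteratedDeriv n (fun s : ℝ => Real.exp (-s)) x = (-1) ^ n * Real.exp (-x) := by
      have := iteratedDeriv_comp_neg n Real.exp x
      rw [this]
      simp [iteratedDeriv_eq_iterate]
    rw [this]
    simp only [Set.mem_Ioi] at hx
    simp
    linarith
  · have : (fun _ : V => b).HasTemperateGrowth := Function.HasTemperateGrowth.const b
    have h2 : (fun v : V => ‖v‖ ^ 2).HasTemperateGrowth := Function.hasTemperateGrowth_norm_sq V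
    exact this.mul h2

abbrev EV (d : ℕ) := EuclideanSpace ℝ (Fin d)

def WE (d : ℕ) (u : ℝ) (v : EV d) : ℝ :=
  (2 * Real.pi * u) ^ (-(d : ℝ)/2) * Real.exp (-(1/(2*u) * ‖v‖^2))

lemma WE_hasFDerivAt (d : ℕ) (u : ℝ) (v : EV d) :
    HasFDerivAt (WE d u) ((-(WE d u v / u)) • innerSL ℝ v) v := by
  have h1 : HasFDerivAt (fun v : EV d => ‖v‖^2) (2 • innerSL ℝ v) v :=
    (hasStrictFDerivAt_norm_sq v).hasFDerivAt
  have h2 := ((h1.const_mul (1/(2*u))).neg.exp).const_mul ((2 * Real.pi * u) ^ (-(d : ℝ)/2))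
  refine h2.congr_fderiv ?_
  ext w
  simp [WE]
  ring

lemma heatKer_eq (d : ℕ) (u : ℝ) (z : Fin d → ℝ) :
    heatKer d u z = WE d u (WithLp.toLp 2 z) := by
  have : ‖WithLp.toLp 2 z‖ ^ 2 = nrm2 z := by
    rw [EuclideanSpace.norm_sq_eq]
    simp [nrm2]
  rw [heatKer, WE, this]
  congr 2
  rw [one_div, div_eq_inv_mul, mul_neg]

/-- `∂_j W_u` -/
def dW (d : ℕ) (j : Fin d) (u : ℝ) (v : EV d) : ℝ := -(WE d u v / u) * v j

lemma fderiv_heatKer (d : ℕ) (j : Fin d) (u : ℝ) (z : Fin d → ℝ) :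
    fderiv ℝ (fun w => heatKer d u w) z (Pi.single j 1) = dW d j u (WithLp.toLp 2 z) := by
  have h1 := WE_hasFDerivAt d u (WithLp.toLp 2 z)
  have h2 : HasFDerivAt (fun z : Fin d → ℝ => (WithLp.toLp 2 z : EV d))
     ((EuclideanSpace.equiv (Fin d) ℝ).symm : (Fin d → ℝ) →L[ℝ] EV d) z :=
    ((EuclideanSpace.equiv (Fin d) ℝ).symm : (Fin d → ℝ) →L[ℝ] EV d).hasFDerivAt
  have h3 := h1.comp z h2
  have e : (fun w => heatKer d u w) = WE d u ∘ fun z : Fin d → ℝ => (WithLp.toLp 2 z : EV d) := by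
    ext w; exact heatKer_eq d u w
  rw [e, h3.fderiv]
  simp only [ContinuousLinearMap.comp_apply, _root_.smul_apply, dW, smul_eq_mul]
  congr 1
  have : ((EuclideanSpace.equiv (Fin d) ℝ).symm : (Fin d → ℝ) →L[ℝ] EV d) (Pi.single j 1)
     = EuclideanSpace.single j (1:ℝ) := rfl
  rw [this]
  simp [EuclideanSpace.inner_single_right]

lemma WE_continuous (d : ℕ) (u : ℝ) : Continuous (WE d u) := by unfold WE; fun_prop

lemma WE_nonneg (d : ℕ) (u : ℝ) (hu : 0 < u) (v : EV d) : 0 ≤ WE d u v := by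
  unfold WE; positivity

/-- Gaussian majorant. -/
def GM (d : ℕ) (u : ℝ) (v : EV d) : ℝ :=
  (Real.sqrt u)⁻¹ * ((2 * Real.pi * u) ^ (-(d : ℝ)/2) * Real.exp (-(1/(4*u)) * ‖v‖^2))

lemma gauss_integrable (d : ℕ) (b : ℝ) (hb : 0 < b) :
    Integrable (fun v : EV d => Real.exp (-b * ‖v‖^2)) := by
  have h := GaussianFourier.integral_rexp_neg_mul_sq_norm (V := EV d) hb
  by_contra hc
  rw [integral_undef hc] at h
  have : 0 < (Real.pi / b) ^ (Module.finrank ℝ (EV d) / 2 : ℝ) := by positivity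
  linarith

lemma GM_integrable (d : ℕ) (u : ℝ) (hu : 0 < u) : Integrable (GM d u) := by
  unfold GM
  exact ((gauss_integrable d (1/(4*u)) (by positivity)).const_mul _).const_mul _

lemma GM_integral (d : ℕ) (u : ℝ) (hu : 0 < u) :
    ∫ v, GM d u v = (Real.sqrt u)⁻¹ * 2 ^ ((d:ℝ)/2) := by
  unfold GM
  rw [integral_const_mul, integral_const_mul,
    GaussianFourier.integral_rexp_neg_mul_sq_norm (by positivity)]
  congr 1
  have : Real.pi / (1 / (4 * u)) = 2 * (2 * Real.pi * u) := by field_simp; ring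
  rw [this, Real.mul_rpow (x := 2) (y := 2 * Real.pi * u) (by norm_num) (by positivity)]
  simp only [finrank_euclideanSpace, Fintype.card_fin]
  rw [mul_left_comm, ← Real.rpow_add (by positivity), neg_div, neg_add_cancel, Real.rpow_zero,
    mul_one]

lemma norm_WE_le (d : ℕ) (u : ℝ) (hu : 0 < u) (v : EV d) :
    WE d u v / u * ‖v‖ ≤ GM d u v := by
  have hs : 0 < Real.sqrt u := Real.sqrt_pos.2 hu
  have hsq : Real.sqrt u ^ 2 = u := Real.sq_sqrt hu.le
  set r := Real.sqrt u
  unfold WE GM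
  have h1 : ‖v‖ / r ≤ Real.exp (1/(4*u) * ‖v‖^2) := by
    have := Real.add_one_le_exp (1/(4*u) * ‖v‖^2)
    refine le_trans ?_ this
    rw [← hsq]
    have e : 1 / (4 * r ^ 2) * ‖v‖ ^ 2 = (‖v‖ / r) ^ 2 / 4 := by field_simp
    rw [e]
    nlinarith [sq_nonneg (‖v‖ / r - 2)]
  have h2 : Real.exp (-(1/(4*u)) * ‖v‖^2) =
      Real.exp (-(1/(2*u) * ‖v‖^2)) * Real.exp (1/(4*u) * ‖v‖^2) := by
    rw [← Real.exp_add]; congr 1; field_simp; ring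
  rw [h2]
  calc _ = r⁻¹ * ((2 * Real.pi * u) ^ (-(d : ℝ)/2) * (Real.exp (-(1/(2*u) * ‖v‖^2)) * (‖v‖ / r))) := by
        generalize Real.exp (-(1/(2*u) * ‖v‖^2)) = a
        generalize (2 * Real.pi * u) ^ (-(d : ℝ)/2) = b
        rw [← hsq]; field_simp
    _ ≤ _ := by gcongr

lemma dW_le (d : ℕ) (j : Fin d) (u : ℝ) (hu : 0 < u) (v : EV d) :
    |dW d j u v| ≤ GM d u v := by
  refine le_trans ?_ (norm_WE_le d u hu v)
  unfold dW
  rw [abs_mul, abs_neg, abs_of_nonneg (div_nonneg (WE_nonneg d u hu v) hu.le)]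
  have := PiLp.norm_apply_le v j
  have h2 := WE_nonneg d u hu v
  rw [Real.norm_eq_abs] at this
  gcongr

lemma dW_continuous (d : ℕ) (j : Fin d) (u : ℝ) : Continuous (dW d j u) := by
  have := WE_continuous d u
  unfold dW; fun_prop

lemma dW_integrable (d : ℕ) (j : Fin d) (u : ℝ) (hu : 0 < u) : Integrable (dW d j u) :=
  (GM_integrable d u hu).mono' (dW_continuous d j u).aestronglyMeasurable
    (Filter.Eventually.of_forall (dW_le d j u hu))

lemma dW_measurable (d : ℕ) (j : Fin d) : Measurable (fun p : ℝ × EV d => dW d j p.1 p.2) := by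
  unfold dW WE; fun_prop

lemma WE_integrable (d : ℕ) (u : ℝ) (hu : 0 < u) : Integrable (WE d u) := by
  unfold WE
  have := (gauss_integrable d (1/(2*u)) (by positivity)).const_mul ((2 * Real.pi * u) ^ (-(d : ℝ)/2))
  simpa only [neg_mul] using this

open FourierTransform in
lemma fourier_WE (d : ℕ) (u : ℝ) (hu : 0 < u) (w : EV d) :
    𝓕 (fun v => (WE d u v : ℂ)) w = (Real.exp (-(2 * Real.pi^2 * u * ‖w‖^2)) : ℝ) := by
  have hb : 0 < ((1/(2*u) : ℝ) : ℂ).re := by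
    rw [Complex.ofReal_re]; positivity
  have h := fourier_gaussian_innerProductSpace hb w
  have e : (fun v : EV d => (WE d u v : ℂ)) = (((2 * Real.pi * u) ^ (-(d : ℝ)/2) : ℝ) : ℂ) •
      (fun v : EV d => Complex.exp (-((1/(2*u) : ℝ) : ℂ) * ‖v‖^2)) := by
    ext v
    simp [WE]
  have h0 : ∀ (c : ℂ) (g : EV d → ℂ), 𝓕 (c • g) w = c • 𝓕 g w := by
    intro c g
    rw [Real.fourier_eq, Real.fourier_eq, ← integral_smul]
    congr 1
    ext v
    rw [Pi.smul_apply, smul_comm]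
  rw [e, h0, h]
  have e2 : ((Real.pi : ℂ) / ((1/(2*u) : ℝ) : ℂ)) ^ (Module.finrank ℝ (EV d) / 2 : ℂ)
     = (((2 * Real.pi * u) ^ ((d : ℝ)/2) : ℝ) : ℂ) := by
    rw [← Complex.ofReal_div, show Real.pi / (1/(2*u)) = 2 * Real.pi * u by field_simp,
      Complex.ofReal_cpow (by positivity)]
    simp
  rw [e2, smul_eq_mul, ← mul_assoc, ← Complex.ofReal_mul, ← Real.rpow_add (by positivity), neg_div,
    neg_add_cancel, Real.rpow_zero, Complex.ofReal_one, one_mul, Complex.ofReal_exp]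
  congr 1
  push_cast
  have : (u:ℂ) ≠ 0 := by exact_mod_cast hu.ne'
  field_simp

open FourierTransform in
lemma fourier_dW (d : ℕ) (j : Fin d) (u : ℝ) (hu : 0 < u) (w : EV d) :
    𝓕 (fun v => (dW d j u v : ℂ)) w =
      (2 * Real.pi * Complex.I * w j) * (Real.exp (-(2 * Real.pi^2 * u * ‖w‖^2)) : ℝ) := by
  have hd : ∀ v, HasFDerivAt (fun v => (WE d u v : ℂ))
      (Complex.ofRealCLM.comp ((-(WE d u v / u)) • innerSL ℝ v)) v := fun v =>
    (Complex.ofRealCLM.hasFDerivAt).comp v (WE_hasFDerivAt d u v)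
  have hfd : fderiv ℝ (fun v => (WE d u v : ℂ)) =
      fun v => (Complex.ofRealCLM.comp ((-(WE d u v / u)) • innerSL ℝ v)) := by
    ext1 v; exact (hd v).fderiv
  have hI : Integrable (fderiv ℝ (fun v => (WE d u v : ℂ))) := by
    rw [hfd]
    refine (GM_integrable d u hu).mono' ?_ (Filter.Eventually.of_forall fun v => ?_)
    · have := WE_continuous d u
      apply Continuous.aestronglyMeasurable
      fun_prop
    · refine le_trans ?_ (norm_WE_le d u hu v)
      refine (ContinuousLinearMap.opNorm_comp_le _ _).trans ?_
      rw [Complex.ofRealCLM_norm, one_mul, norm_smul, innerSL_apply_norm, norm_neg,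
        Real.norm_of_nonneg (div_nonneg (WE_nonneg d u hu v) hu.le)]
  have h := Real.fourier_fderiv (WE_integrable d u hu).ofReal
    (fun v => (hd v).differentiableAt) hI
  have h1 := congrArg (fun L => L w (EuclideanSpace.single j (1:ℝ))) h
  simp only [VectorFourier.fourierSMulRight_apply] at h1
  have h2 : (𝓕 (fderiv ℝ (fun v => (WE d u v : ℂ))) w) (EuclideanSpace.single j (1:ℝ)) =
      𝓕 (fun v => (dW d j u v : ℂ)) w := by
    rw [Real.fourier_eq, Real.fourier_eq, ContinuousLinearMap.integral_apply]
    · congr 1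
      ext v
      rw [hfd]
      rw [Circle.smul_def, _root_.smul_apply, ContinuousLinearMap.comp_apply,
        _root_.smul_apply, innerSL_apply_apply, EuclideanSpace.inner_single_right, Circle.smul_def]
      simp [dW]
    · exact (Real.fourierIntegral_convergent_iff w).2 hI
  rw [← h2, h1, fourier_WE d u hu w]
  rw [_root_.neg_apply, _root_.neg_apply, innerSL_apply_apply, EuclideanSpace.inner_single_right]
  simp
  ring
lemma GM_le (d : ℕ) (u : ℝ) (v : EV d) (hu : 0 < u) :
    GM d u v ≤ (Real.sqrt u)⁻¹ * ((2 * Real.pi * u) ^ (-(d : ℝ)/2) * 1) := by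
  unfold GM
  gcongr
  rw [Real.exp_le_one_iff]
  have : 0 ≤ 1 / (4 * u) * ‖v‖^2 := by positivity
  linarith

/-- `f * ∂_j W_u` -/
def Dj (d : ℕ) (j : Fin d) (f : EV d → ℝ) (u : ℝ) (x : EV d) : ℝ := ∫ y, f y * dW d j u (x - y)

open FourierTransform SchwartzMap Convolution in
lemma Dj_fourier (d : ℕ) (j : Fin d) (f : EV d → ℝ) (F : 𝓢(EV d, ℂ)) (hF : ∀ x, F x = (f x : ℂ))
    (u : ℝ) (hu : 0 < u) :
    ∃ S : 𝓢(EV d, ℂ), (∀ x, S x = (Dj d j f u x : ℂ)) ∧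
      ∀ w, 𝓕 S w = ((2 * Real.pi * Complex.I * w j) *
        (Real.exp (-(2 * Real.pi^2 * u * ‖w‖^2)) : ℝ)) * 𝓕 F w := by
  set m : EV d → ℂ := fun w => (2 * Real.pi * Complex.I * w j) *
        (Real.exp (-(2 * Real.pi^2 * u * ‖w‖^2)) : ℝ) with hm
  have hmt : m.HasTemperateGrowth := by
    have h1 := gauss_temperate (V := EV d) (2 * Real.pi^2 * u) (by positivity)
    have h2 : (fun w : EV d => ((Real.exp (-(2 * Real.pi^2 * u * ‖w‖^2)) : ℝ) : ℂ)).HasTemperateGrowth :=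
      Function.Complex.hasTemperateGrowth_ofReal.comp h1
    have h3 : (fun w : EV d => (w j : ℂ)).HasTemperateGrowth :=
      (Complex.ofRealCLM.comp (EuclideanSpace.proj j : EV d →L[ℝ] ℝ)).hasTemperateGrowth
    exact ((Function.HasTemperateGrowth.const (2 * Real.pi * Complex.I : ℂ)).mul h3).mul h2
  set T : 𝓢(EV d, ℂ) := smulLeftCLM ℂ m (𝓕 F) with hT
  have hTa : ∀ w, T w = m w * 𝓕 F w := fun w => by
    rw [hT, smulLeftCLM_apply_apply hmt, smul_eq_mul]
  set k : EV d → ℂ := fun v => (dW d j u v : ℂ) with hk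
  have hki : Integrable k := (dW_integrable d j u hu).ofReal
  have hkc : Continuous k := Complex.continuous_ofReal.comp (dW_continuous d j u)
  have hconv : ∀ w, 𝓕 ((F : EV d → ℂ) ⋆[ContinuousLinearMap.mul ℂ ℂ] k) w = T w := by
    intro w
    rw [Real.fourier_mul_convolution_eq F.integrable hki, hk, fourier_dW d j u hu, hTa,
      fourier_coe, mul_comm]
  have hfun : 𝓕 ((F : EV d → ℂ) ⋆[ContinuousLinearMap.mul ℂ ℂ] k) = (T : EV d → ℂ) := funext hconv
  refine ⟨𝓕⁻ T, fun x => ?_, fun w => ?_⟩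
  · rw [fourierInv_coe, ← hfun, Continuous.fourierInv_fourier_eq]
    · rw [convolution_def, Dj, ← integral_complex_ofReal]
      congr 1
      ext y
      simp [hF, hk]
    · refine BddAbove.continuous_convolution_right_of_integrable _ ?_ F.integrable hkc
      refine ⟨(Real.sqrt u)⁻¹ * ((2 * Real.pi * u) ^ (-(d : ℝ)/2) * 1), ?_⟩
      rintro - ⟨v, rfl⟩
      simp only [hk, Complex.norm_real, Real.norm_eq_abs]
      exact (dW_le d j u hu v).trans (GM_le d u v hu)
    · exact F.integrable.integrable_convolution _ hki
    · rw [hfun]; exact T.integrable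
  · rw [FourierTransform.fourier_fourierInv_eq, hTa]

open FourierTransform SchwartzMap in
lemma schwartz_sq_integrable (d : ℕ) (S : 𝓢(EV d, ℂ)) : Integrable (fun x => ‖S x‖^2) := by
  have := S.memLp 2
  simpa using this.integrable_norm_pow (by norm_num)

open FourierTransform SchwartzMap in
lemma plancherel_l (d : ℕ) (S : 𝓢(EV d, ℂ)) :
    ∫⁻ x, ENNReal.ofReal (‖S x‖^2) = ∫⁻ w, ENNReal.ofReal (‖𝓕 S w‖^2) := by
  rw [← ofReal_integral_eq_lintegral_ofReal (schwartz_sq_integrable d S)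
    (Filter.Eventually.of_forall fun x => by positivity),
    ← ofReal_integral_eq_lintegral_ofReal (schwartz_sq_integrable d (𝓕 S))
    (Filter.Eventually.of_forall fun x => by positivity), integral_norm_sq_fourier]

lemma lint_exp (a b : ℝ) (ha : 0 ≤ a) (hab : a ≤ b) :
    ∫⁻ u in Set.Ioi (0:ℝ), ENNReal.ofReal (a * Real.exp (-(b * u))) ≤ 1 := by
  rcases ha.eq_or_lt with rfl | ha
  · simp
  have hb : 0 < b := ha.trans_le hab
  have hi : IntegrableOn (fun u => Real.exp (-b * u)) (Set.Ioi 0) := exp_neg_integrableOn_Ioi 0 hb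
  have hi2 : IntegrableOn (fun u => a * Real.exp (-(b * u))) (Set.Ioi 0) := by
    have := hi.const_mul a
    simp only [neg_mul] at this
    exact this
  rw [← ofReal_integral_eq_lintegral_ofReal hi2
    (Filter.Eventually.of_forall fun x => by positivity), integral_const_mul]
  have := integral_exp_mul_Ioi (a := -b) (by linarith) 0
  simp only [neg_mul] at this
  rw [this, ENNReal.ofReal_le_one]
  simp
  rw [← div_eq_mul_inv, div_le_one hb]
  exact hab

open FourierTransform SchwartzMap in
lemma energy (d : ℕ) (j : Fin d) (f : EV d → ℝ) (F : 𝓢(EV d, ℂ)) (hF : ∀ x, F x = (f x : ℂ)) :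
    ∫⁻ u in Set.Ioi (0:ℝ), ∫⁻ x, ENNReal.ofReal ((Dj d j f u x)^2) ≤
      ∫⁻ x, ENNReal.ofReal ((f x)^2) := by
  have h1 : ∀ u ∈ Set.Ioi (0:ℝ), ∫⁻ x, ENNReal.ofReal ((Dj d j f u x)^2) =
      ∫⁻ w, ENNReal.ofReal (4 * Real.pi^2 * (w j)^2 * Real.exp (-(4 * Real.pi^2 * ‖w‖^2 * u)))
        * ENNReal.ofReal (‖𝓕 F w‖^2) := by
    intro u hu
    obtain ⟨S, hS, hS2⟩ := Dj_fourier d j f F hF u hu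
    have := plancherel_l d S
    simp only [hS, hS2, Complex.norm_real, Real.norm_eq_abs, sq_abs] at this
    rw [this]
    refine lintegral_congr fun w => ?_
    rw [← ENNReal.ofReal_mul (by positivity)]
    congr 1
    rw [norm_mul, norm_mul, norm_mul, norm_mul, norm_mul, Complex.norm_I, Complex.norm_real,
      Complex.norm_real, Complex.norm_real, Real.norm_of_nonneg (Real.exp_pos _).le, mul_pow, mul_pow,
      ← Real.exp_nat_mul, mul_pow, mul_pow, mul_pow, Real.norm_eq_abs, Real.norm_eq_abs, sq_abs, sq_abs]
    congr 1
    congr 1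
    · norm_num
    · congr 1
      push_cast
      ring
  rw [setLIntegral_congr_fun measurableSet_Ioi h1, lintegral_lintegral_swap]
  · calc _ ≤ ∫⁻ w, ENNReal.ofReal (‖𝓕 F w‖^2) := by
          refine lintegral_mono fun w => ?_
          simp only
          rw [lintegral_mul_const _ (by fun_prop)]
          refine (mul_le_mul_left (lint_exp _ _ (by positivity) ?_) _).trans_eq (one_mul _)
          have := PiLp.norm_apply_le w j
          rw [← sq_abs (w j), ← Real.norm_eq_abs]
          gcongr
      _ = _ := by
          rw [← plancherel_l]
          simp [hF]
  · have : Continuous (fun w => (𝓕 F) w) := (𝓕 F).continuous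
    apply Measurable.aemeasurable
    fun_prop
lemma lint_cs {α : Type*} [MeasurableSpace α] (μ : Measure α) (a b : α → ℝ≥0∞)
    (ha : AEMeasurable a μ) (hb : AEMeasurable b μ) :
    (∫⁻ x, a x * b x ∂μ) ^ 2 ≤ (∫⁻ x, a x ^ 2 ∂μ) * (∫⁻ x, b x ^ 2 ∂μ) := by
  have h := ENNReal.lintegral_mul_le_Lp_mul_Lq μ (Real.HolderConjugate.two_two) ha hb
  simp only [Pi.mul_apply, ENNReal.rpow_two] at h
  have h2 : ∀ y : ℝ≥0∞, (y ^ (1 / (2:ℝ))) ^ 2 = y := by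
    intro y
    rw [← ENNReal.rpow_two, ← ENNReal.rpow_mul]
    norm_num
  calc _ ≤ ((∫⁻ x, a x ^ 2 ∂μ) ^ (1 / (2:ℝ)) * (∫⁻ x, b x ^ 2 ∂μ) ^ (1 / (2:ℝ))) ^ 2 := by gcongr
    _ = _ := by rw [mul_pow, h2, h2]

lemma Dj_measurable (d : ℕ) (j : Fin d) (f : EV d → ℝ) (hf : Continuous f) :
    Measurable (fun p : ℝ × EV d => Dj d j f p.1 p.2) := by
  unfold Dj
  have hm : Measurable (fun q : (ℝ × EV d) × EV d => f q.2 * dW d j q.1.1 (q.1.2 - q.2)) := by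
    have h1 := hf.measurable
    have h2 : Measurable (fun q : (ℝ × EV d) × EV d => dW d j q.1.1 (q.1.2 - q.2)) :=
      (dW_measurable d j).comp
        (g := fun p : ℝ × EV d => dW d j p.1 p.2)
        (f := fun q : (ℝ × EV d) × EV d => (q.1.1, q.1.2 - q.2)) (by fun_prop)
    exact (h1.comp measurable_snd).mul h2
  exact (hm.stronglyMeasurable.integral_prod_right (ν := volume)).measurable

lemma fubini_int (d k : ℕ) (j : Fin d) (E : Set ℝ) (hEs : E ⊆ Set.Ioi 0) (f : EV d → ℝ)
    (hf : Continuous f) (M : ℝ) (hM0 : 0 ≤ M) (hM : ∀ y, |f y| ≤ M) (x : EV d) (t : ℝ) (ht : 0 < t)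
    (hE : MeasurableSet E) :
    Integrable (fun p : EV d × ℝ => f p.1 * (PhiK k t p.2 * dW d j p.2 (x - p.1)))
      (volume.prod (volume.restrict E)) := by
  obtain ⟨C, hC, hb⟩ := PhiK_bound k
  have hm : Measurable (fun p : EV d × ℝ => f p.1 * (PhiK k t p.2 * dW d j p.2 (x - p.1))) := by
    have h1 := hf.measurable
    have h2 : Measurable (fun p : EV d × ℝ => dW d j p.2 (x - p.1)) :=
      (dW_measurable d j).comp
        (g := fun p : ℝ × EV d => dW d j p.1 p.2)
        (f := fun p : EV d × ℝ => (p.2, x - p.1)) (by fun_prop)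
    have h3 : Measurable (fun p : EV d × ℝ => PhiK k t p.2) :=
      (PhiK_measurable k).comp (g := fun p : ℝ × ℝ => PhiK k p.1 p.2)
        (f := fun p : EV d × ℝ => (t, p.2)) (by fun_prop)
    exact (h1.comp measurable_fst).mul (h3.mul h2)
  refine ⟨hm.aestronglyMeasurable, ?_⟩
  rw [hasFiniteIntegral_iff_enorm, lintegral_prod_symm _ hm.enorm.aemeasurable]
  have hin : ∀ u ∈ E, ∫⁻ y, ‖f y * (PhiK k t u * dW d j u (x - y))‖ₑ ≤
      ENNReal.ofReal (M * C * 2 ^ ((d:ℝ)/2)) *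
        ENNReal.ofReal (t / (u + t ^ 2) * (Real.sqrt u)⁻¹) := by
    intro u hu
    have hu' : 0 < u := hEs hu
    calc _ ≤ ∫⁻ y, ENNReal.ofReal (M * (C * (t / (u + t ^ 2)))) * ENNReal.ofReal (GM d u (x - y)) := by
          refine lintegral_mono fun y => ?_
          simp only
          rw [← ENNReal.ofReal_mul (by positivity), Real.enorm_eq_ofReal_abs]
          apply ENNReal.ofReal_le_ofReal
          rw [abs_mul, abs_mul, ← mul_assoc]
          have h1 := hM y
          have h2 := hb t u ht hu'
          have h3 := dW_le d j u hu' (x - y)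
          gcongr
      _ = ENNReal.ofReal (M * (C * (t / (u + t ^ 2)))) * ∫⁻ y, ENNReal.ofReal (GM d u y) := by
          rw [lintegral_const_mul' _ _ ENNReal.ofReal_ne_top,
            lintegral_sub_left_eq_self (fun y => ENNReal.ofReal (GM d u y)) x]
      _ = _ := by
          rw [← ofReal_integral_eq_lintegral_ofReal (GM_integrable d u hu')
            (Filter.Eventually.of_forall fun y => by simp only [GM, Pi.zero_apply]; positivity),
            GM_integral d u hu', ← ENNReal.ofReal_mul (by positivity),
            ← ENNReal.ofReal_mul (by positivity)]
          congr 1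
          ring
  calc _ ≤ ∫⁻ u in E, ENNReal.ofReal (M * C * 2 ^ ((d:ℝ)/2)) *
        ENNReal.ofReal (t / (u + t ^ 2) * (Real.sqrt u)⁻¹) := setLIntegral_mono' hE hin
    _ ≤ ∫⁻ u in Set.Ioi 0, ENNReal.ofReal (M * C * 2 ^ ((d:ℝ)/2)) *
        ENNReal.ofReal (t / (u + t ^ 2) * (Real.sqrt u)⁻¹) := lintegral_mono_set hEs
    _ < ⊤ := by
      rw [lintegral_const_mul' _ _ ENNReal.ofReal_ne_top, lint_u t ht]
      exact ENNReal.mul_lt_top ENNReal.ofReal_lt_top ENNReal.ofReal_lt_top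

lemma conv_eq (d k : ℕ) (j : Fin d) (E : Set ℝ) (hE : MeasurableSet E) (hEs : E ⊆ Set.Ioi 0)
    (f : (Fin d → ℝ) → ℝ)
    (hf : Continuous f) (M : ℝ) (hM0 : 0 ≤ M) (hM : ∀ y, |f y| ≤ M) (x : Fin d → ℝ) (t : ℝ)
    (ht : 0 < t) :
    ∫ y, f y * Ufrak d k j E 0 (x - y) t =
      ∫ u in E, PhiK k t u * Dj d j (fun v => f (WithLp.ofLp v)) u (WithLp.toLp 2 x) := by
  have hU : ∀ z, Ufrak d k j E 0 z t = ∫ u in E, PhiK k t u * dW d j u (WithLp.toLp 2 z) := by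
    intro z
    unfold Ufrak
    rw [← integral_const_mul]
    refine setIntegral_congr_fun hE fun u hu => ?_
    simp only
    rw [iter_eq k t u (hEs hu), fderiv_heatKer, PhiK, add_zero]
    ring
  have hfE : Continuous (fun v : EV d => f (WithLp.ofLp v)) :=
    hf.comp (PiLp.continuous_ofLp 2 _)
  have hprodint := fubini_int d k j E hEs (fun v => f (WithLp.ofLp v)) hfE M hM0 (fun v => hM _)
    (WithLp.toLp 2 x) t ht hE
  have hmp := (PiLp.volume_preserving_ofLp (Fin d)).integral_comp
    (MeasurableEquiv.toLp 2 (Fin d → ℝ)).symm.measurableEmbedding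
    (fun y => f y * Ufrak d k j E 0 (x - y) t)
  rw [← hmp]
  calc _ = ∫ y : EV d, ∫ u in E, f (WithLp.ofLp y) * (PhiK k t u * dW d j u (WithLp.toLp 2 x - y)) := by
        congr 1
        ext y
        rw [hU, ← integral_const_mul]
        rfl
    _ = ∫ u in E, ∫ y : EV d, f (WithLp.ofLp y) * (PhiK k t u * dW d j u (WithLp.toLp 2 x - y)) :=
        integral_integral_swap hprodint
    _ = _ := by
        congr 1
        ext u
        rw [Dj, ← integral_const_mul]
        congr 1
        ext y
        ring

lemma ptwise (k : ℕ) (C : ℝ) (hC : 0 < C) (hb : ∀ t u : ℝ, 0 < t → 0 < u →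
    |PhiK k t u| ≤ C * (t / (u + t ^ 2))) (E : Set ℝ) (hE : MeasurableSet E)
    (hEs : E ⊆ Set.Ioi 0) (D : ℝ → ℝ) (hD : Measurable D) (t : ℝ) (ht : 0 < t) :
    ENNReal.ofReal ((∫ u in E, PhiK k t u * D u) ^ 2 / t) ≤
      ENNReal.ofReal (C ^ 2 * Real.pi) * ∫⁻ u in Set.Ioi (0:ℝ),
        ENNReal.ofReal (Real.sqrt u / (u + t ^ 2)) * ENNReal.ofReal (D u ^ 2) := by
  set G := ∫ u in E, PhiK k t u * D u with hG
  have h1 : ‖G‖ₑ ≤ ENNReal.ofReal C * ∫⁻ u in Set.Ioi (0:ℝ),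
      ENNReal.ofReal (Real.sqrt (t / (u + t ^ 2) * (Real.sqrt u)⁻¹)) *
      ENNReal.ofReal (Real.sqrt (t / (u + t ^ 2) * Real.sqrt u) * |D u|) := by
    refine (enorm_integral_le_lintegral_enorm _).trans ?_
    refine (lintegral_mono_set hEs).trans ?_
    rw [← lintegral_const_mul' _ _ ENNReal.ofReal_ne_top]
    refine setLIntegral_mono' measurableSet_Ioi fun u hu => ?_
    have hu' : 0 < u := hu
    rw [← ENNReal.ofReal_mul (by positivity), ← ENNReal.ofReal_mul (by positivity),
      Real.enorm_eq_ofReal_abs]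
    apply ENNReal.ofReal_le_ofReal
    rw [← mul_assoc (Real.sqrt _), ← Real.sqrt_mul (by positivity), abs_mul, ← mul_assoc]
    have e : t / (u + t ^ 2) * (Real.sqrt u)⁻¹ * (t / (u + t ^ 2) * Real.sqrt u) =
        (t / (u + t ^ 2)) ^ 2 := by
      have : 0 < Real.sqrt u := Real.sqrt_pos.2 hu'
      field_simp
    rw [e, Real.sqrt_sq (by positivity)]
    have := hb t u ht hu'
    gcongr
  have h2 : ENNReal.ofReal (G ^ 2) ≤ ENNReal.ofReal (C ^ 2 * Real.pi) *
      ∫⁻ u in Set.Ioi (0:ℝ), ENNReal.ofReal (t / (u + t ^ 2) * Real.sqrt u * D u ^ 2) := by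
    rw [← sq_abs, ENNReal.ofReal_pow (abs_nonneg _), ← Real.enorm_eq_ofReal_abs]
    calc _ ≤ _ := pow_le_pow_left₀ zero_le h1 2
      _ = ENNReal.ofReal (C ^ 2) * (∫⁻ u in Set.Ioi (0:ℝ),
      ENNReal.ofReal (Real.sqrt (t / (u + t ^ 2) * (Real.sqrt u)⁻¹)) *
      ENNReal.ofReal (Real.sqrt (t / (u + t ^ 2) * Real.sqrt u) * |D u|)) ^ 2 := by
        rw [mul_pow, ENNReal.ofReal_pow hC.le]
      _ ≤ ENNReal.ofReal (C ^ 2) * ((∫⁻ u in Set.Ioi (0:ℝ),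
        ENNReal.ofReal (Real.sqrt (t / (u + t ^ 2) * (Real.sqrt u)⁻¹)) ^ 2) *
        (∫⁻ u in Set.Ioi (0:ℝ),
          ENNReal.ofReal (Real.sqrt (t / (u + t ^ 2) * Real.sqrt u) * |D u|) ^ 2)) := by
        gcongr
        apply lint_cs
        · apply Measurable.aemeasurable; fun_prop
        · apply Measurable.aemeasurable
          have : Measurable (fun u => |D u|) := hD.abs
          fun_prop
      _ = _ := by
        rw [ENNReal.ofReal_mul (p := C ^ 2) (by positivity), mul_assoc]
        congr 2
        · rw [← lint_u t ht]
          refine setLIntegral_congr_fun measurableSet_Ioi fun u hu => ?_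
          have hu' : 0 < u := hu
          rw [← ENNReal.ofReal_pow (by positivity), Real.sq_sqrt (by positivity)]
        · refine setLIntegral_congr_fun measurableSet_Ioi fun u hu => ?_
          have hu' : 0 < u := hu
          rw [← ENNReal.ofReal_pow (by positivity), mul_pow, Real.sq_sqrt (by positivity), sq_abs]
  rw [div_eq_mul_inv, ENNReal.ofReal_mul (by positivity)]
  calc _ ≤ _ := mul_le_mul_left h2 _
    _ = _ := by
      rw [mul_assoc, ← lintegral_mul_const' _ _ ENNReal.ofReal_ne_top]
      congr 1
      refine setLIntegral_congr_fun measurableSet_Ioi fun u hu => ?_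
      have hu' : 0 < u := hu
      rw [← ENNReal.ofReal_mul (by positivity), ← ENNReal.ofReal_mul (by positivity)]
      congr 1
      field_simp
set_option maxHeartbeats 1000000 in
theorem statement19 (d : ℕ) (hd : 1 ≤ d) (k : ℕ) :
    ∃ C > 0, ∀ j : Fin d, ∀ E : Set ℝ, MeasurableSet E → E ⊆ Set.Ioi 0 →
      ∀ f : (Fin d → ℝ) → ℝ, ContDiff ℝ (⊤ : ℕ∞) f → HasCompactSupport f →
      (∫⁻ x, ∫⁻ t in Set.Ioi (0:ℝ),
          ENNReal.ofReal ((∫ y, f y * Ufrak d k j E 0 (x - y) t) ^ 2 / t)) ≤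
        ENNReal.ofReal C * eLpNorm f 2 (volume : Measure (Fin d → ℝ)) ^ 2 := by
  obtain ⟨C, hC, hb⟩ := PhiK_bound k
  refine ⟨C ^ 2 * Real.pi * (Real.pi / 2), by positivity, ?_⟩
  intro j E hE hEs f hf hfc
  obtain ⟨M, hM⟩ := hf.continuous.bounded_above_of_compact_support hfc
  have hM0 : 0 ≤ M := (norm_nonneg _).trans (hM 0)
  set fE : EV d → ℝ := fun v => f (WithLp.ofLp v) with hfE
  have hfEs : ContDiff ℝ (⊤ : ℕ∞) fE := hf.comp (EuclideanSpace.equiv (Fin d) ℝ).contDiff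
  have hfEc : HasCompactSupport fE :=
    hfc.comp_homeomorph (EuclideanSpace.equiv (Fin d) ℝ).toHomeomorph
  have hFs : ContDiff ℝ (⊤ : ℕ∞) (fun v => (fE v : ℂ)) := Complex.ofRealCLM.contDiff.comp hfEs
  have hFc : HasCompactSupport (fun v => (fE v : ℂ)) :=
    hfEc.comp_left (g := fun r : ℝ => (r : ℂ)) Complex.ofReal_zero
  have hDm := Dj_measurable d j fE hfEs.continuous
  have hen := energy d j fE (hFc.toSchwartzMap hFs) (fun x => rfl)
  have hst : ∀ x : Fin d → ℝ, (∫⁻ t in Set.Ioi (0:ℝ),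
          ENNReal.ofReal ((∫ y, f y * Ufrak d k j E 0 (x - y) t) ^ 2 / t)) ≤
      ENNReal.ofReal (C ^ 2 * Real.pi * (Real.pi / 2)) *
        ∫⁻ u in Set.Ioi (0:ℝ), ENNReal.ofReal (Dj d j fE u (WithLp.toLp 2 x) ^ 2) := by
    intro x
    have hDx : Measurable (fun u => Dj d j fE u (WithLp.toLp 2 x)) :=
      hDm.comp (g := fun p : ℝ × EV d => Dj d j fE p.1 p.2)
        (f := fun u => (u, WithLp.toLp 2 x)) (by fun_prop)
    calc _ ≤ ∫⁻ t in Set.Ioi (0:ℝ), ENNReal.ofReal (C ^ 2 * Real.pi) * ∫⁻ u in Set.Ioi (0:ℝ),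
        ENNReal.ofReal (Real.sqrt u / (u + t ^ 2)) *
          ENNReal.ofReal (Dj d j fE u (WithLp.toLp 2 x) ^ 2) := by
          refine setLIntegral_mono' measurableSet_Ioi fun t ht => ?_
          rw [conv_eq d k j E hE hEs f hf.continuous M hM0 hM x t ht]
          exact ptwise k C hC hb E hE hEs _ hDx t ht
      _ = ENNReal.ofReal (C ^ 2 * Real.pi) * ∫⁻ u in Set.Ioi (0:ℝ), ∫⁻ t in Set.Ioi (0:ℝ),
        ENNReal.ofReal (Real.sqrt u / (u + t ^ 2)) *
          ENNReal.ofReal (Dj d j fE u (WithLp.toLp 2 x) ^ 2) := by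
          rw [lintegral_const_mul' _ _ ENNReal.ofReal_ne_top, lintegral_lintegral_swap]
          apply Measurable.aemeasurable
          have : Measurable (fun p : ℝ × ℝ => Dj d j fE p.2 (WithLp.toLp 2 x)) :=
            hDx.comp measurable_snd
          fun_prop
      _ = _ := by
          rw [ENNReal.ofReal_mul (p := C ^ 2 * Real.pi) (by positivity), mul_assoc,
            ← lintegral_const_mul' (ENNReal.ofReal (Real.pi / 2)) _ ENNReal.ofReal_ne_top]
          congr 1
          refine setLIntegral_congr_fun measurableSet_Ioi fun u hu => ?_
          try beta_reduce
          rw [lintegral_mul_const' _ _ ENNReal.ofReal_ne_top, lint_t u hu]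
  calc _ ≤ _ := lintegral_mono hst
    _ = ENNReal.ofReal (C ^ 2 * Real.pi * (Real.pi / 2)) * ∫⁻ v : EV d,
        ∫⁻ u in Set.Ioi (0:ℝ), ENNReal.ofReal (Dj d j fE u v ^ 2) := by
        rw [lintegral_const_mul' _ _ ENNReal.ofReal_ne_top]
        congr 1
        exact (PiLp.volume_preserving_toLp (Fin d)).lintegral_comp_emb
          (MeasurableEquiv.toLp 2 (Fin d → ℝ)).measurableEmbedding
          (fun v => ∫⁻ u in Set.Ioi (0:ℝ), ENNReal.ofReal (Dj d j fE u v ^ 2))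
    _ = ENNReal.ofReal (C ^ 2 * Real.pi * (Real.pi / 2)) *
        ∫⁻ u in Set.Ioi (0:ℝ), ∫⁻ v : EV d, ENNReal.ofReal (Dj d j fE u v ^ 2) := by
        congr 1
        apply lintegral_lintegral_swap
        apply Measurable.aemeasurable
        have : Measurable (fun p : EV d × ℝ => Dj d j fE p.2 p.1) := 
          hDm.comp (g := fun p : ℝ × EV d => Dj d j fE p.1 p.2) (f := Prod.swap) measurable_swap
        exact (this.pow_const 2).ennreal_ofReal
    _ ≤ ENNReal.ofReal (C ^ 2 * Real.pi * (Real.pi / 2)) *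
        ∫⁻ v : EV d, ENNReal.ofReal (fE v ^ 2) := mul_le_mul' le_rfl hen
    _ = _ := by
        congr 1
        rw [(PiLp.volume_preserving_ofLp (Fin d)).lintegral_comp_emb
          (MeasurableEquiv.toLp 2 (Fin d → ℝ)).symm.measurableEmbedding
          (fun v => ENNReal.ofReal (f v ^ 2))]
        have := eLpNorm_nnreal_pow_eq_lintegral (f := f) (μ := (volume : Measure (Fin d → ℝ)))
          (p := 2) two_ne_zero
        simp only [NNReal.coe_ofNat, ENNReal.rpow_two, ENNReal.coe_ofNat] at this
        rw [this]
        refine lintegral_congr fun v => ?_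
        rw [Real.enorm_eq_ofReal_abs, ← ENNReal.ofReal_pow (abs_nonneg _), sq_abs]
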